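/- Let n ≥ 7 and let t be an integer with 2 ≤ t ≤ ⌊(n−1)/2⌋ − 1, and set M := M(n,t) = n − t − 2. Let F be a finite field whose characteristic does not divide t, and let A_1, A_2, …, A_M, B_1, B_2, …, B_{t+1} and C be subspaces of a finite-dimensional F-vector space V. Then: H(C) ≤ (1/(t+2)) · Σ_{i∈[t+1]} H(A_i) + I(C; B_{[t+1]}, A_{[t+2, M]}) + H(C ∣ A_{[M]}) + Σ_{i∈[M]} I(C; A_{[M]−i}) + Σ_{i∈[t+1]} [ I(C; B_i) + H(C ∣ A_i, B_i) + I(C; A_{[M]−i}, B_i) ]. -/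

import Mathlib

open Module

section Helpers

variable {F V : Type*} [Field F] [AddCommGroup V] [Module F V]

theorem Submodule.exists_linearMap_sub_mem_of_le_sup {D P Q : Submodule F V} (h : D ≤ P ⊔ Q) :
    ∃ g : D →ₗ[F] P, ∀ x : D, (x : V) - g x ∈ Q := by
  let b := Basis.ofVectorSpace F D
  have hb : ∀ k, ∃ p : P, (b k : V) - p ∈ Q := fun k => by
    obtain ⟨p, hp, q, hq, hpq⟩ := Submodule.mem_sup.mp (h (b k).2)
    exact ⟨⟨p, hp⟩, by simpa [← hpq] using hq⟩
  choose p hp using hb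
  refine ⟨b.constr F p, fun x => ?_⟩
  have hx : (⊤ : Submodule F D) ≤ Q.comap (D.subtype - P.subtype ∘ₗ b.constr F p) := by
    rw [← b.span_eq, Submodule.span_le]
    rintro _ ⟨k, rfl⟩
    simpa using hp k
  simpa using hx (Submodule.mem_top (x := x))

theorem Submodule.exists_linearMap_sum_eq_of_le_iSup {ι : Type*} {D : Submodule F V}
    (s : Finset ι) (A : ι → Submodule F V) (h : D ≤ ⨆ i ∈ s, A i) :
    ∃ f : ∀ i, D →ₗ[F] A i, ∀ x : D, ∑ i ∈ s, (f i x : V) = x := by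
  let b := Basis.ofVectorSpace F D
  have hb : ∀ k, ∃ μ : ∀ i, A i, ∑ i ∈ s, (μ i : V) = b k := fun k =>
    (Submodule.mem_iSup_finset_iff_exists_sum A _).mp (h (b k).2)
  choose μ hμ using hb
  refine ⟨fun i => b.constr F fun k => μ k i, fun x => ?_⟩
  have hmap : ∑ i ∈ s, (A i).subtype ∘ₗ b.constr F (fun k => μ k i) = D.subtype :=
    b.ext fun k => by simpa using hμ k
  simpa using congrArg (· x) hmap

variable [FiniteDimensional F V]

theorem Submodule.finrank_le_finrank_inf_add {C D : Submodule F V} (hD : D ≤ C)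
    (P : Submodule F V) :
    (finrank F D : ℚ) ≤
      finrank F (D ⊓ P : Submodule F V)
        + ((finrank F C : ℚ) - finrank F (C ⊓ P : Submodule F V)) := by
  have h := Submodule.finrank_sup_add_finrank_inf_eq D (C ⊓ P)
  have hle := Submodule.finrank_mono (sup_le hD (inf_le_left : C ⊓ P ≤ C))
  rw [← inf_assoc, inf_eq_left.mpr hD] at h
  have h' : (finrank F D : ℚ) + finrank F (C ⊓ P : Submodule F V) =
      finrank F (D ⊔ C ⊓ P : Submodule F V) + finrank F (D ⊓ P : Submodule F V) := by
    exact_mod_cast h.symm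
  have hle' : (finrank F (D ⊔ C ⊓ P : Submodule F V) : ℚ) ≤ finrank F C := by
    exact_mod_cast hle
  linarith

theorem Submodule.exists_le_disjoint_finrank_le {C D : Submodule F V} (hD : D ≤ C)
    (Q : Submodule F V) :
    ∃ E ≤ D, Disjoint E Q ∧
      (finrank F D : ℚ) ≤ finrank F E + finrank F (C ⊓ Q : Submodule F V) := by
  obtain ⟨E, hE⟩ := exists_isCompl (D ⊓ Q)
  refine ⟨D ⊓ E, inf_le_left, ?_, ?_⟩
  · rw [disjoint_iff, inf_right_comm]
    exact hE.inf_eq_bot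
  · have hsup : D ⊓ Q ⊔ D ⊓ E = D := by
      rw [inf_comm D E, ← sup_inf_assoc_of_le E (inf_le_left : D ⊓ Q ≤ D), hE.sup_eq_top,
        top_inf_eq]
    have h1 := Submodule.finrank_add_le_finrank_add_finrank (D ⊓ Q) (D ⊓ E)
    rw [hsup] at h1
    have h2 := Submodule.finrank_mono (inf_le_inf_right Q hD)
    have h3 : finrank F D ≤ finrank F (D ⊓ E : Submodule F V)
        + finrank F (C ⊓ Q : Submodule F V) := by omega
    exact_mod_cast h3

theorem Submodule.exists_forall_le_finrank_le {ι : Type*} {C D : Submodule F V} (hD : D ≤ C)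
    (s : Finset ι) (P : ι → Submodule F V) :
    ∃ E ≤ D, (∀ i ∈ s, E ≤ P i) ∧
      (finrank F D : ℚ) ≤ finrank F E
        + ∑ i ∈ s, ((finrank F C : ℚ) - finrank F (C ⊓ P i : Submodule F V)) := by
  classical
  induction s using Finset.induction_on with
  | empty => exact ⟨D, le_rfl, by simp, by simp⟩
  | insert a s ha ih =>
    obtain ⟨E, hED, hE, hdim⟩ := ih
    refine ⟨E ⊓ P a, inf_le_left.trans hED, ?_, ?_⟩
    · simp only [Finset.forall_mem_insert]
      exact ⟨inf_le_right, fun i hi => inf_le_left.trans (hE i hi)⟩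
    · have := Submodule.finrank_le_finrank_inf_add (hED.trans hD) (P a)
      rw [Finset.sum_insert ha]
      linarith

theorem Submodule.exists_forall_disjoint_finrank_le {ι : Type*} {C D : Submodule F V}
    (hD : D ≤ C) (s : Finset ι) (Q : ι → Submodule F V) :
    ∃ E ≤ D, (∀ i ∈ s, Disjoint E (Q i)) ∧
      (finrank F D : ℚ) ≤ finrank F E
        + ∑ i ∈ s, (finrank F (C ⊓ Q i : Submodule F V) : ℚ) := by
  classical
  induction s using Finset.induction_on with
  | empty => exact ⟨D, le_rfl, by simp, by simp⟩
  | insert a s ha ih =>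
    obtain ⟨E, hED, hE, hdim⟩ := ih
    obtain ⟨E', hE'E, hE', hdim'⟩ :=
      Submodule.exists_le_disjoint_finrank_le (hED.trans hD) (Q a)
    refine ⟨E', hE'E.trans hED, ?_, ?_⟩
    · simp only [Finset.forall_mem_insert]
      exact ⟨hE', fun i hi => (hE i hi).mono_left hE'E⟩
    · rw [Finset.sum_insert ha]
      linarith

theorem LinearMap.two_mul_finrank_le_finrank_add_finrank_ker_sub {W U : Type*}
    [AddCommGroup W] [Module F W] [FiniteDimensional F W]
    [AddCommGroup U] [Module F U] [FiniteDimensional F U]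
    (f g : W →ₗ[F] U) (hf : Function.Injective f) (hg : Function.Injective g)
    (hfg : ∀ x y, f x = g y → x = y) :
    2 * finrank F W ≤ finrank F U + finrank F (LinearMap.ker (f - g)) := by
  have h1 := LinearMap.finrank_range_of_inj hf
  have h2 := LinearMap.finrank_range_of_inj hg
  have h3 := Submodule.finrank_sup_add_finrank_inf_eq (LinearMap.range f) (LinearMap.range g)
  have h4 := Submodule.finrank_le (LinearMap.range f ⊔ LinearMap.range g)
  have h5 : LinearMap.range f ⊓ LinearMap.range g ≤ (LinearMap.ker (f - g)).map f := by
    rintro _ ⟨⟨x, rfl⟩, ⟨y, hy⟩⟩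
    obtain rfl := hfg x y hy.symm
    exact ⟨x, by simp [hy], rfl⟩
  have h6 := (Submodule.finrank_mono h5).trans (Submodule.finrank_map_le f _)
  omega

theorem finrank_le_of_disjoint_decomposition {D : Submodule F V} {A B : ℕ → Submodule F V}
    {t M : ℕ} (htM : t + 1 ≤ M) (htF : (t : F) ≠ 0)
    (hDA : D ≤ ⨆ i ∈ Finset.Icc 1 M, A i)
    (hDAB : ∀ i ∈ Finset.Icc 1 (t + 1), D ≤ A i ⊔ B i)
    (hA : ∀ i ∈ Finset.Icc 1 M, Disjoint D (⨆ j ∈ (Finset.Icc 1 M).erase i, A j))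
    (hB : ∀ i ∈ Finset.Icc 1 (t + 1), Disjoint D (B i))
    (hAB : ∀ i ∈ Finset.Icc 1 (t + 1),
      Disjoint D ((⨆ j ∈ (Finset.Icc 1 M).erase i, A j) ⊔ B i))
    (hBA : Disjoint D ((⨆ i ∈ Finset.Icc 1 (t + 1), B i) ⊔ ⨆ i ∈ Finset.Icc (t + 2) M, A i)) :
    (t + 2 : ℚ) * finrank F D ≤ ∑ i ∈ Finset.Icc 1 (t + 1), (finrank F (A i) : ℚ) := by
  have hsub : Finset.Icc 1 (t + 1) ⊆ Finset.Icc 1 M := Finset.Icc_subset_Icc_right htM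
  obtain ⟨f, hf⟩ := Submodule.exists_linearMap_sum_eq_of_le_iSup _ A hDA
  have hg : ∀ i, ∃ g : D →ₗ[F] A i, i ∈ Finset.Icc 1 (t + 1) → ∀ x : D, (x : V) - g x ∈ B i := by
    intro i
    by_cases hi : i ∈ Finset.Icc 1 (t + 1)
    · obtain ⟨g, hg⟩ := Submodule.exists_linearMap_sub_mem_of_le_sup (hDAB i hi)
      exact ⟨g, fun _ => hg⟩
    · exact ⟨0, fun h => absurd h hi⟩
  choose g hg using hg
  have hrest : ∀ i ∈ Finset.Icc 1 M, ∀ x : D,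
      (x : V) - f i x ∈ ⨆ j ∈ (Finset.Icc 1 M).erase i, A j := by
    intro i hi x
    rw [← hf x, ← Finset.add_sum_erase _ _ hi, add_sub_cancel_left]
    exact Submodule.sum_mem _ fun j hj => Submodule.mem_iSup_of_mem j
      (Submodule.mem_iSup_of_mem hj (f j x).2)
  have hker : ∀ i ∈ Finset.Icc 1 (t + 1),
      2 * finrank F D ≤ finrank F (A i) + finrank F (LinearMap.ker (f i - g i)) := by
    intro i hi
    apply LinearMap.two_mul_finrank_le_finrank_add_finrank_ker_sub
    · refine (injective_iff_map_eq_zero _).mpr fun x hx => Subtype.ext ?_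
      have := hrest i (hsub hi) x
      rw [hx, ZeroMemClass.coe_zero, sub_zero] at this
      exact Submodule.disjoint_def.mp (hA i (hsub hi)) x x.2 this
    · refine (injective_iff_map_eq_zero _).mpr fun x hx => Subtype.ext ?_
      have := hg i hi x
      rw [hx, ZeroMemClass.coe_zero, sub_zero] at this
      exact Submodule.disjoint_def.mp (hB i hi) x x.2 this
    · intro x y hxy
      refine sub_eq_zero.mp (Subtype.ext ?_)
      refine Submodule.disjoint_def.mp (hAB i hi) _ (x - y).2 ?_
      have hmem := Submodule.sub_mem _ (Submodule.mem_sup_left (hrest i (hsub hi) x))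
        (Submodule.mem_sup_right (hg i hi y))
      rwa [hxy, sub_sub_sub_cancel_right] at hmem
  obtain ⟨E, -, hE, hdim⟩ := Submodule.exists_forall_le_finrank_le (le_refl (⊤ : Submodule F D))
    (Finset.Icc 1 (t + 1)) fun i => LinearMap.ker (f i - g i)
  have hEbot : E = ⊥ := by
    refine (Submodule.eq_bot_iff _).mpr fun x hx => Subtype.ext ?_
    refine Submodule.disjoint_def.mp hBA x x.2 ?_
    have hsplit : ∑ i ∈ Finset.Icc 1 (t + 1), (f i x : V)
        + ∑ i ∈ Finset.Icc (t + 2) M, (f i x : V) = x := by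
      rw [← hf x, ← Finset.sum_union]
      · congr 1
        ext i
        simp only [Finset.mem_union, Finset.mem_Icc]
        omega
      · refine Finset.disjoint_left.mpr fun i hi hi' => ?_
        simp only [Finset.mem_Icc] at hi hi'
        omega
    have hfB : ∀ i ∈ Finset.Icc 1 (t + 1), (x : V) - f i x ∈ B i := by
      intro i hi
      have hfg : f i x = g i x := by simpa [sub_eq_zero] using hE i hi hx
      rw [hfg]
      exact hg i hi x
    have hmem := Submodule.sub_mem _
      (Submodule.mem_sup_left (T := ⨆ i ∈ Finset.Icc (t + 2) M, A i)
        (Submodule.sum_mem (⨆ i ∈ Finset.Icc 1 (t + 1), B i) fun i hi =>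
          Submodule.mem_iSup_of_mem i (Submodule.mem_iSup_of_mem hi (hfB i hi))))
      (Submodule.mem_sup_right (S := ⨆ i ∈ Finset.Icc 1 (t + 1), B i)
        (Submodule.sum_mem (⨆ i ∈ Finset.Icc (t + 2) M, A i) fun i hi =>
          Submodule.mem_iSup_of_mem i (Submodule.mem_iSup_of_mem hi (f i x).2)))
    have heq : ∑ i ∈ Finset.Icc 1 (t + 1), ((x : V) - f i x)
        - ∑ i ∈ Finset.Icc (t + 2) M, (f i x : V) = (t : F) • (x : V) := by
      rw [Finset.sum_sub_distrib, sub_sub, hsplit, Finset.sum_const, Nat.card_Icc,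
        Nat.add_sub_cancel, succ_nsmul, add_sub_cancel_right, Nat.cast_smul_eq_nsmul]
    rw [heq] at hmem
    exact (Submodule.smul_mem_iff _ htF).mp hmem
  have hinf : ∀ i, finrank F (⊤ ⊓ LinearMap.ker (f i - g i) : Submodule F D)
      = finrank F (LinearMap.ker (f i - g i)) := fun i => by rw [top_inf_eq]
  subst hEbot
  simp only [hinf, finrank_top, finrank_bot, Nat.cast_zero, zero_add] at hdim
  have hle : ∑ i ∈ Finset.Icc 1 (t + 1),
      ((finrank F D : ℚ) - finrank F (LinearMap.ker (f i - g i)))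
      ≤ ∑ i ∈ Finset.Icc 1 (t + 1), ((finrank F (A i) : ℚ) - finrank F D) := by
    refine Finset.sum_le_sum fun i hi => ?_
    have : (2 * finrank F D : ℚ) ≤ finrank F (A i) + finrank F (LinearMap.ker (f i - g i)) := by
      exact_mod_cast hker i hi
    linarith
  rw [Finset.sum_sub_distrib (fun i => (finrank F (A i) : ℚ)), Finset.sum_const, Nat.card_Icc,
    Nat.add_sub_cancel, nsmul_eq_mul, Nat.cast_add_one] at hle
  linarith

end Helpers

/-- for `n ≥ 7`, `2 ≤ t ≤ ⌊(n−1)/2⌋ − 1` and `M = M(n,t) = n − t − 2`, a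
characteristic-dependent linear rank inequality over finite fields whose characteristic
does not divide `t`, for subspaces `A 1, …, A M`, `B 1, …, B (t+1)` and `C` of a
finite-dimensional `F`-vector space.  Here `H(X) = dim X`, `I(X; Y…) = dim (X ⊓ ΣY)`,
`H(X ∣ Y…) = dim X − dim (X ⊓ ΣY)`, `A_{[M]} = A 1 + ⋯ + A M`, `A_{[M]−i} = Σ_{j≠i} A j`,
`A_{[t+2,M]} = Σ_{j=t+2}^{M} A j` and `B_{[t+1]} = B 1 + ⋯ + B (t+1)`. -/
theorem statement9 {F : Type*} [Field F] [Fintype F] {V : Type*} [AddCommGroup V]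
    [Module F V] [FiniteDimensional F V]
    (n t M : ℕ) (hn : 7 ≤ n) (ht2 : 2 ≤ t) (ht : t ≤ (n - 1) / 2 - 1)
    (hM : M = n - t - 2)
    (hchar : ¬ (ringChar F ∣ t))
    (A B : ℕ → Submodule F V) (C : Submodule F V) :
    (Module.finrank F C : ℚ) ≤
      (1 / (t + 2 : ℚ)) * ∑ i ∈ Finset.Icc 1 (t + 1), (Module.finrank F (A i) : ℚ)
      + (Module.finrank F ((C ⊓ ((⨆ i ∈ Finset.Icc 1 (t + 1), B i) ⊔
          (⨆ i ∈ Finset.Icc (t + 2) M, A i)) : Submodule F V)) : ℚ)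
      + ((Module.finrank F C : ℚ)
          - (Module.finrank F ((C ⊓ ⨆ i ∈ Finset.Icc 1 M, A i : Submodule F V)) : ℚ))
      + ∑ i ∈ Finset.Icc 1 M,
          (Module.finrank F ((C ⊓ ⨆ j ∈ (Finset.Icc 1 M).erase i, A j
            : Submodule F V)) : ℚ)
      + ∑ i ∈ Finset.Icc 1 (t + 1),
          ((Module.finrank F ((C ⊓ B i : Submodule F V)) : ℚ)
            + ((Module.finrank F C : ℚ)
                - (Module.finrank F ((C ⊓ (A i ⊔ B i) : Submodule F V)) : ℚ))
            + (Module.finrank F ((C ⊓ ((⨆ j ∈ (Finset.Icc 1 M).erase i, A j) ⊔ B i)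
                : Submodule F V)) : ℚ)) := by
  have htM : t + 1 ≤ M := by omega
  have htF : (t : F) ≠ 0 := fun h => hchar ((ringChar.spec F t).mp h)
  obtain ⟨D₁, h₁C, h₁, d₁⟩ := Submodule.exists_forall_le_finrank_le (le_refl C)
    (Finset.Icc 1 (t + 1)) fun i => A i ⊔ B i
  have d₂ := Submodule.finrank_le_finrank_inf_add h₁C (⨆ i ∈ Finset.Icc 1 M, A i)
  obtain ⟨D₃, h₃le, h₃, d₃⟩ := Submodule.exists_forall_disjoint_finrank_le
    ((inf_le_left : D₁ ⊓ (⨆ i ∈ Finset.Icc 1 M, A i) ≤ D₁).trans h₁C) (Finset.Icc 1 M)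
    fun i => ⨆ j ∈ (Finset.Icc 1 M).erase i, A j
  have h₃C := h₃le.trans (inf_le_left.trans h₁C)
  obtain ⟨D₄, h₄le, h₄, d₄⟩ := Submodule.exists_forall_disjoint_finrank_le h₃C
    (Finset.Icc 1 (t + 1)) B
  obtain ⟨D₅, h₅le, h₅, d₅⟩ := Submodule.exists_forall_disjoint_finrank_le (h₄le.trans h₃C)
    (Finset.Icc 1 (t + 1)) fun i => (⨆ j ∈ (Finset.Icc 1 M).erase i, A j) ⊔ B i
  obtain ⟨D, hle, hD, d₆⟩ := Submodule.exists_le_disjoint_finrank_le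
    (h₅le.trans (h₄le.trans h₃C))
    ((⨆ i ∈ Finset.Icc 1 (t + 1), B i) ⊔ ⨆ i ∈ Finset.Icc (t + 2) M, A i)
  have hD₄ := hle.trans h₅le
  have hD₃ := hD₄.trans h₄le
  have hD₂ := hD₃.trans h₃le
  have key := finrank_le_of_disjoint_decomposition htM htF (hD₂.trans inf_le_right)
    (fun i hi => (hD₂.trans inf_le_left).trans (h₁ i hi))
    (fun i hi => (h₃ i hi).mono_left hD₃) (fun i hi => (h₄ i hi).mono_left hD₄)
    (fun i hi => (h₅ i hi).mono_left hle) hD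
  have hdiv : (Module.finrank F D : ℚ) ≤
      (1 / (t + 2 : ℚ)) * ∑ i ∈ Finset.Icc 1 (t + 1), (Module.finrank F (A i) : ℚ) := by
    rw [one_div, inv_mul_eq_div, le_div_iff₀ (by positivity), mul_comm]
    exact key
  rw [Finset.sum_add_distrib, Finset.sum_add_distrib]
  linarith
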